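/- (Schumacher–Westmoreland–Wootters bound, generalized.) Let {p_i, ρ_i} be an ensemble of letter states on a finite alphabet A with average state η_i, and let I be an instrument with finite outcome set Ω, operations O(ω) and POV measure E. Then χ{p_i, ρ_i} ≥ I_c{p_i, ρ_i; E} + Σ_{ω: p_f(ω)>0} p_f(ω) χ{p_{i|f}(·|ω), ρ_f^•(ω)}, where ρ_f^α(ω) = O(ω)[ρ_i(α)]/p_{f|i}(ω|α) are the a posteriori states of the letter states and the ensemble {p_{i|f}(·|ω), ρ_f^•(ω)} has average state ρ_f(ω) = O(ω)[η_i]/p_f(ω). -/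

import Mathlib

open Matrix Finset
open scoped BigOperators ComplexOrder

noncomputable section

/-- Matrix logarithm of a Hermitian matrix via the spectral decomposition
(with the convention `Real.log 0 = 0` on the kernel); `0` for non-Hermitian matrices. -/
def matLog {d : ℕ} (A : Matrix (Fin d) (Fin d) ℂ) : Matrix (Fin d) (Fin d) ℂ :=
  if hA : A.IsHermitian then
    (hA.eigenvectorUnitary : Matrix (Fin d) (Fin d) ℂ) *
      Matrix.diagonal (fun i => (Real.log (hA.eigenvalues i) : ℂ)) *
      star (hA.eigenvectorUnitary : Matrix (Fin d) (Fin d) ℂ)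
  else 0

/-- The von Neumann entropy `S_q(ρ) = −Tr(ρ log ρ)`. -/
def vnEntropy {d : ℕ} (ρ : Matrix (Fin d) (Fin d) ℂ) : ℝ :=
  -(Matrix.trace (ρ * matLog ρ)).re

/-- The quantum relative entropy `S_q(ρ‖φ) = Tr(ρ (log ρ − log φ))`. -/
def qRelEntropy {d : ℕ} (ρ φ : Matrix (Fin d) (Fin d) ℂ) : ℝ :=
  (Matrix.trace (ρ * (matLog ρ - matLog φ))).re

/-- The classical relative entropy `S_c(p‖q) = Σ_{ω : p ω > 0} p ω log (p ω / q ω)`. -/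
def cRelEntropy {Ω : Type*} [Fintype Ω] (p q : Ω → ℝ) : ℝ :=
  ∑ ω ∈ Finset.univ.filter (fun ω => 0 < p ω), p ω * Real.log (p ω / q ω)

/-- The probability of outcome `ω` for POV measure `E` in the state `ρ`. -/
def povProb {d : ℕ} {Ω : Type*} (E : Ω → Matrix (Fin d) (Fin d) ℂ)
    (ρ : Matrix (Fin d) (Fin d) ℂ) (ω : Ω) : ℝ :=
  (Matrix.trace (E ω * ρ)).re

/-- The χ-quantity of the ensemble `{p, σ}` (relative entropies w.r.t. the average state). -/
def chiQuantity {d : ℕ} {X : Type*} [Fintype X] (p : X → ℝ)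
    (σ : X → Matrix (Fin d) (Fin d) ℂ) : ℝ :=
  ∑ x ∈ Finset.univ.filter (fun x => 0 < p x),
    p x * qRelEntropy (σ x) (∑ y, p y • σ y)

/-- The operation `O(ω)[ρ] = Σ_k V_k^ω ρ (V_k^ω)†` of the instrument with Kraus family `V`. -/
def instrOp {d : ℕ} {Ω K : Type*} [Fintype K] (V : Ω → K → Matrix (Fin d) (Fin d) ℂ)
    (ω : Ω) (ρ : Matrix (Fin d) (Fin d) ℂ) : Matrix (Fin d) (Fin d) ℂ :=
  ∑ k, V ω k * ρ * (V ω k)ᴴ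

/-- The POV measure `E(ω) = Σ_k (V_k^ω)† V_k^ω` associated with the instrument `V`. -/
def instrPOV {d : ℕ} {Ω K : Type*} [Fintype K] (V : Ω → K → Matrix (Fin d) (Fin d) ℂ)
    (ω : Ω) : Matrix (Fin d) (Fin d) ℂ :=
  ∑ k, (V ω k)ᴴ * V ω k

/-- The outcome probability `p_ρ(ω) = Tr(E(ω) ρ)` of the instrument `V`. -/
def outcomeProb {d : ℕ} {Ω K : Type*} [Fintype K] (V : Ω → K → Matrix (Fin d) (Fin d) ℂ)
    (ρ : Matrix (Fin d) (Fin d) ℂ) (ω : Ω) : ℝ :=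
  (Matrix.trace (instrPOV V ω * ρ)).re

/-- The a posteriori state `π_ρ(ω) = O(ω)[ρ] / p_ρ(ω)` of the instrument `V`. -/
def postState {d : ℕ} {Ω K : Type*} [Fintype K] (V : Ω → K → Matrix (Fin d) (Fin d) ℂ)
    (ρ : Matrix (Fin d) (Fin d) ℂ) (ω : Ω) : Matrix (Fin d) (Fin d) ℂ :=
  (outcomeProb V ρ ω)⁻¹ • instrOp V ω ρ

/-- The classical input/output mutual information `I_c{p, ρ; E}` for the ensemble `{p, ρ}`
measured with the POV measure `E`. -/
def mutualInfo {d : ℕ} {A Ω : Type*} [Fintype A] [Fintype Ω]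
    (p : A → ℝ) (ρ : A → Matrix (Fin d) (Fin d) ℂ)
    (E : Ω → Matrix (Fin d) (Fin d) ℂ) : ℝ :=
  ∑ x ∈ Finset.univ.filter (fun x : A × Ω => 0 < p x.1 * povProb E (ρ x.1) x.2),
    (p x.1 * povProb E (ρ x.1) x.2) *
      Real.log ((p x.1 * povProb E (ρ x.1) x.2) /
        (p x.1 * povProb E (∑ α, p α • ρ α) x.2))

/-- The quantum information gain `I_q(ρ; I)` of the instrument `V` on the state `ρ`. -/
def infoGain {d : ℕ} {Ω K : Type*} [Fintype Ω] [Fintype K]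
    (V : Ω → K → Matrix (Fin d) (Fin d) ℂ) (ρ : Matrix (Fin d) (Fin d) ℂ) : ℝ :=
  vnEntropy ρ - ∑ ω ∈ Finset.univ.filter (fun ω => 0 < outcomeProb V ρ ω),
    outcomeProb V ρ ω * vnEntropy (postState V ρ ω)

/-- A pure state: a rank-one orthogonal projection. -/
def IsPureState {d : ℕ} (ρ : Matrix (Fin d) (Fin d) ℂ) : Prop :=
  ρ.IsHermitian ∧ ρ * ρ = ρ ∧ ρ.rank = 1

end

/-- The matrix `U diag(a) U†`. -/
noncomputable def conjDiag {d : ℕ} (U : Matrix (Fin d) (Fin d) ℂ) (a : Fin d → ℝ) :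
    Matrix (Fin d) (Fin d) ℂ :=
  U * Matrix.diagonal (fun i => (a i : ℂ)) * star U

/-- The eigenbasis of a Hermitian matrix, as a matrix. -/
noncomputable abbrev eigU {d : ℕ} {A : Matrix (Fin d) (Fin d) ℂ} (hA : A.IsHermitian) :
    Matrix (Fin d) (Fin d) ℂ :=
  (hA.eigenvectorUnitary : Matrix (Fin d) (Fin d) ℂ)

/-- The inner product of the `j`-th eigenvector of `B` with the `i`-th eigenvector of `A`. -/
noncomputable def overlap {d : ℕ} {A B : Matrix (Fin d) (Fin d) ℂ} (hA : A.IsHermitian) (hB : B.IsHermitian)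
    (j i : Fin d) : ℂ :=
  (star (eigU hB) * eigU hA) j i

section Spectral

variable {d : ℕ} {A B : Matrix (Fin d) (Fin d) ℂ}

lemma star_eigU_mul (hA : A.IsHermitian) : star (eigU hA) * eigU hA = 1 :=
  Unitary.coe_star_mul_self hA.eigenvectorUnitary

lemma eigU_mul_star (hA : A.IsHermitian) : eigU hA * star (eigU hA) = 1 :=
  Unitary.coe_mul_star_self hA.eigenvectorUnitary

lemma eq_conjDiag_eigenvalues (hA : A.IsHermitian) : A = conjDiag (eigU hA) hA.eigenvalues := by
  conv_lhs => rw [hA.spectral_theorem, Unitary.conjStarAlgAut_apply]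
  rfl

lemma smul_eq_conjDiag (hA : A.IsHermitian) (a : ℝ) :
    a • A = conjDiag (eigU hA) (fun i => a * hA.eigenvalues i) := by
  conv_lhs => rw [eq_conjDiag_eigenvalues hA]
  have : (Matrix.diagonal fun i => ((a * hA.eigenvalues i : ℝ) : ℂ)) =
      a • Matrix.diagonal fun i => ((hA.eigenvalues i : ℝ) : ℂ) := by
    ext i j
    by_cases h : i = j <;> simp [Matrix.diagonal, h]
  rw [conjDiag, conjDiag, this, Matrix.mul_smul, Matrix.smul_mul]

lemma matLog_eq_cfc (hA : A.IsHermitian) : matLog A = cfc Real.log A := by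
  rw [hA.cfc_eq, Matrix.IsHermitian.cfc, Unitary.conjStarAlgAut_apply, matLog, dif_pos hA]
  rfl

lemma matLog_smul (hA : A.IsHermitian) (a : ℝ) :
    matLog (a • A) = conjDiag (eigU hA) (fun i => Real.log (a * hA.eigenvalues i)) := by
  have haA : (a • A).IsHermitian := by
    rw [Matrix.IsHermitian, Matrix.conjTranspose_smul, hA.eq, star_trivial]
  rw [matLog_eq_cfc haA, ← cfc_comp_const_mul a Real.log A
    ((A.finite_real_spectrum.image _).continuousOn _) hA.isSelfAdjoint,
    hA.cfc_eq, Matrix.IsHermitian.cfc, Unitary.conjStarAlgAut_apply]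
  rfl

lemma trace_conjDiag_mul_conjDiag (U W : Matrix (Fin d) (Fin d) ℂ) (a b : Fin d → ℝ) :
    (conjDiag U a * conjDiag W b).trace =
      ((∑ j, ∑ i, ‖(star W * U) j i‖ ^ 2 * a i * b j : ℝ) : ℂ) := by
  have h1 : (conjDiag U a * conjDiag W b).trace =
      ((star W * U) * Matrix.diagonal (fun i => (a i : ℂ)) * star (star W * U) *
        Matrix.diagonal (fun j => (b j : ℂ))).trace := by
    rw [conjDiag, conjDiag, star_mul, star_star, Matrix.trace_mul_comm]
    simp only [Matrix.mul_assoc]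
    rw [Matrix.trace_mul_comm]
    simp only [Matrix.mul_assoc]
    rw [Matrix.trace_mul_comm]
    simp only [Matrix.mul_assoc]
  rw [h1, Matrix.trace]
  push_cast
  refine Finset.sum_congr rfl fun j _ => ?_
  rw [Matrix.diag_apply, Matrix.mul_diagonal, Matrix.mul_apply, Finset.sum_mul]
  refine Finset.sum_congr rfl fun i _ => ?_
  rw [Matrix.mul_diagonal, Matrix.star_apply, ← Complex.mul_conj']
  simp only [RCLike.star_def]
  ring

lemma trace_conjDiag_self {U : Matrix (Fin d) (Fin d) ℂ} (hU : star U * U = 1) (a b : Fin d → ℝ) :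
    (conjDiag U a * conjDiag U b).trace = ((∑ i, a i * b i : ℝ) : ℂ) := by
  rw [trace_conjDiag_mul_conjDiag, hU]
  simp [Matrix.one_apply, apply_ite]

lemma sum_overlap (hA : A.IsHermitian) (hB : B.IsHermitian) (i : Fin d) :
    ∑ j, ‖overlap hA hB j i‖ ^ 2 = 1 := by
  have h : (star (star (eigU hB) * eigU hA) * (star (eigU hB) * eigU hA)) i i = 1 := by
    rw [star_mul, star_star, Matrix.mul_assoc, ← Matrix.mul_assoc (eigU hB), eigU_mul_star,
      Matrix.one_mul, star_eigU_mul, Matrix.one_apply_eq]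
  rw [Matrix.mul_apply] at h
  have h' : ((∑ j, ‖overlap hA hB j i‖ ^ 2 : ℝ) : ℂ) = 1 := by
    rw [← h]
    push_cast
    refine Finset.sum_congr rfl fun j _ => ?_
    rw [Matrix.star_apply, ← Complex.conj_mul']
    rfl
  exact_mod_cast h'

lemma trace_re_eq_sum (hA : A.IsHermitian) : A.trace.re = ∑ i, hA.eigenvalues i := by
  rw [hA.trace_eq_sum_eigenvalues]
  simp

lemma trace_re_eq_sum_overlap (hA : A.IsHermitian) (hB : B.IsHermitian) :
    A.trace.re = ∑ j, ∑ i, ‖overlap hA hB j i‖ ^ 2 * hA.eigenvalues i := by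
  rw [trace_re_eq_sum hA, Finset.sum_comm]
  simp_rw [← Finset.sum_mul, sum_overlap, one_mul]

lemma qRelEntropy_smul_smul (hA : A.IsHermitian) (hB : B.IsHermitian) (a b : ℝ) :
    qRelEntropy (a • A) (b • B) =
      ∑ j, ∑ i, ‖overlap hA hB j i‖ ^ 2 * (a * hA.eigenvalues i) *
        (Real.log (a * hA.eigenvalues i) - Real.log (b * hB.eigenvalues j)) := by
  rw [qRelEntropy, Matrix.mul_sub, Matrix.trace_sub, matLog_smul hA, matLog_smul hB,
    smul_eq_conjDiag hA, trace_conjDiag_self (star_eigU_mul hA), trace_conjDiag_mul_conjDiag,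
    Complex.sub_re, Complex.ofReal_re, Complex.ofReal_re]
  have h : ∑ i, a * hA.eigenvalues i * Real.log (a * hA.eigenvalues i) =
      ∑ j, ∑ i, ‖overlap hA hB j i‖ ^ 2 *
        (a * hA.eigenvalues i * Real.log (a * hA.eigenvalues i)) := by
    rw [Finset.sum_comm]
    simp_rw [← Finset.sum_mul, sum_overlap, one_mul]
  rw [h, ← Finset.sum_sub_distrib]
  refine Finset.sum_congr rfl fun j _ => ?_
  rw [← Finset.sum_sub_distrib]
  refine Finset.sum_congr rfl fun i _ => ?_
  rw [overlap]
  ring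

lemma qRelEntropy_eq_sum (hA : A.IsHermitian) (hB : B.IsHermitian) :
    qRelEntropy A B =
      ∑ j, ∑ i, ‖overlap hA hB j i‖ ^ 2 * hA.eigenvalues i *
        (Real.log (hA.eigenvalues i) - Real.log (hB.eigenvalues j)) := by
  simpa using qRelEntropy_smul_smul hA hB 1 1

/-- If `A` is dominated by a multiple of `B`, then the overlap of the range of `A` with the kernel
of `B` vanishes. -/
lemma overlap_mul_eigenvalue_eq_zero (hA : A.PosSemidef) (hB : B.IsHermitian) {c : ℝ} (hc : 0 < c)
    (hAB : (B - c • A).PosSemidef) {i j : Fin d} (hj : hB.eigenvalues j = 0) :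
    ‖overlap hA.isHermitian hB j i‖ ^ 2 * hA.isHermitian.eigenvalues i = 0 := by
  set v : Fin d → ℂ := fun k => eigU hB k j
  have hBv : B *ᵥ v = 0 := by
    have := hB.mulVec_eigenvectorBasis j
    rw [hj, zero_smul] at this
    exact this
  have hnn := hAB.dotProduct_mulVec_nonneg v
  rw [Matrix.sub_mulVec, hBv, Matrix.smul_mulVec, zero_sub, dotProduct_neg, dotProduct_smul] at hnn
  have hA0 := hA.dotProduct_mulVec_nonneg v
  have hval : star v ⬝ᵥ (A *ᵥ v) =
      ((∑ i, ‖overlap hA.isHermitian hB j i‖ ^ 2 * hA.isHermitian.eigenvalues i : ℝ) : ℂ) := by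
    have h1 : star v ⬝ᵥ (A *ᵥ v) = (star (eigU hB) * A * eigU hB) j j := by
      rw [Matrix.mul_assoc, Matrix.mul_apply]
      rfl
    have h2 : star (eigU hB) * A * eigU hB = (star (eigU hB) * eigU hA.isHermitian) *
        Matrix.diagonal (fun i => (hA.isHermitian.eigenvalues i : ℂ)) *
        star (star (eigU hB) * eigU hA.isHermitian) := by
      conv_lhs => rw [eq_conjDiag_eigenvalues hA.isHermitian]
      rw [conjDiag, star_mul, star_star]
      simp only [Matrix.mul_assoc]
    rw [h1, h2, Matrix.mul_apply]
    push_cast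
    refine Finset.sum_congr rfl fun i _ => ?_
    rw [Matrix.mul_diagonal, Matrix.star_apply, ← Complex.mul_conj', overlap]
    simp only [RCLike.star_def]
    ring
  rw [hval] at hnn
  have hle : ∑ i, ‖overlap hA.isHermitian hB j i‖ ^ 2 * hA.isHermitian.eigenvalues i ≤ 0 := by
    rw [Complex.real_smul, ← Complex.ofReal_mul, ← Complex.ofReal_neg,
      Complex.zero_le_real] at hnn
    nlinarith
  have hterm : ∀ i ∈ Finset.univ,
      0 ≤ ‖overlap hA.isHermitian hB j i‖ ^ 2 * hA.isHermitian.eigenvalues i :=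
    fun i _ => mul_nonneg (sq_nonneg _) (hA.eigenvalues_nonneg i)
  exact (Finset.sum_eq_zero_iff_of_nonneg hterm).mp
    (le_antisymm hle (Finset.sum_nonneg hterm)) i (Finset.mem_univ i)

lemma qRelEntropy_smul_smul_eq (hA : A.PosSemidef) (hB : B.IsHermitian) {c : ℝ} (hc : 0 < c)
    (hAB : (B - c • A).PosSemidef) {a b : ℝ} (ha : 0 < a) (hb : 0 < b) :
    qRelEntropy (a • A) (b • B) =
      a * (qRelEntropy A B + (Real.log a - Real.log b) * A.trace.re) := by
  rw [qRelEntropy_smul_smul hA.isHermitian hB, qRelEntropy_eq_sum hA.isHermitian hB,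
    trace_re_eq_sum_overlap hA.isHermitian hB, Finset.mul_sum, ← Finset.sum_add_distrib,
    Finset.mul_sum]
  refine Finset.sum_congr rfl fun j _ => ?_
  rw [Finset.mul_sum, ← Finset.sum_add_distrib, Finset.mul_sum]
  refine Finset.sum_congr rfl fun i _ => ?_
  by_cases h0 : ‖overlap hA.isHermitian hB j i‖ ^ 2 * hA.isHermitian.eigenvalues i = 0
  · linear_combination (a * (Real.log (a * hA.isHermitian.eigenvalues i) -
      Real.log (b * hB.eigenvalues j)) - a * (Real.log (hA.isHermitian.eigenvalues i) -
      Real.log (hB.eigenvalues j)) - a * (Real.log a - Real.log b)) * h0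
  · have hj : hB.eigenvalues j ≠ 0 := fun hj =>
      h0 (overlap_mul_eigenvalue_eq_zero hA hB hc hAB hj)
    rw [Real.log_mul ha.ne' (right_ne_zero_of_mul h0), Real.log_mul hb.ne' hj]
    ring

end Spectral

section Variational

variable {d : ℕ} {A B : Matrix (Fin d) (Fin d) ℂ}

/-- The quasi-entropy `⟨A, (L_B + s R_A)⁻¹ A⟩`, where `L_B` and `R_A` are left and right
multiplication. -/
noncomputable def resolventForm (hA : A.IsHermitian) (hB : B.IsHermitian) (s : ℝ) : ℝ :=
  ∑ j, ∑ i, ‖overlap hA hB j i‖ ^ 2 *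
    (hA.eigenvalues i ^ 2 / (hB.eigenvalues j + s * hA.eigenvalues i))

/-- The concave quadratic functional whose maximum is `resolventForm`. -/
noncomputable def resolventFunctional (A B : Matrix (Fin d) (Fin d) ℂ) (s : ℝ)
    (Y : Matrix (Fin d) (Fin d) ℂ) : ℝ :=
  2 * (star Y * A).trace.re - (Y * star Y * B).trace.re - s * (star Y * Y * A).trace.re

lemma resolventFunctional_eq_sum (hA : A.IsHermitian) (hB : B.IsHermitian) (s : ℝ)
    (Z : Matrix (Fin d) (Fin d) ℂ) :
    resolventFunctional A B s (eigU hB * Z * star (eigU hA)) =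
      ∑ j, ∑ i, (2 * (star (Z j i) * overlap hA hB j i).re * hA.eigenvalues i -
        (hB.eigenvalues j + s * hA.eigenvalues i) * ‖Z j i‖ ^ 2) := by
  set U := eigU hA
  set W := eigU hB
  have hU : star U * U = 1 := star_eigU_mul hA
  have hW : star W * W = 1 := star_eigU_mul hB
  set DA := Matrix.diagonal fun i => (hA.eigenvalues i : ℂ)
  set DB := Matrix.diagonal fun i => (hB.eigenvalues i : ℂ)
  have hAe : A = U * DA * star U := eq_conjDiag_eigenvalues hA
  have hBe : B = W * DB * star W := eq_conjDiag_eigenvalues hB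
  have hU' : ∀ M : Matrix (Fin d) (Fin d) ℂ, star U * (U * M) = M := fun M => by
    rw [← Matrix.mul_assoc, hU, Matrix.one_mul]
  have hW' : ∀ M : Matrix (Fin d) (Fin d) ℂ, star W * (W * M) = M := fun M => by
    rw [← Matrix.mul_assoc, hW, Matrix.one_mul]
  have h1 : (star (W * Z * star U) * A).trace.re =
      ∑ j, ∑ i, (star (Z j i) * overlap hA hB j i).re * hA.eigenvalues i := by
    have : (star (W * Z * star U) * A).trace = (star Z * ((star W * U) * DA)).trace := by
      conv_lhs => rw [hAe]
      simp only [star_mul, star_star, Matrix.mul_assoc]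
      rw [Matrix.trace_mul_comm]
      simp only [Matrix.mul_assoc, hU, Matrix.mul_one]
    rw [this, Matrix.trace, Complex.re_sum, Finset.sum_comm]
    refine Finset.sum_congr rfl fun i _ => ?_
    rw [Matrix.diag_apply, Matrix.mul_apply, Complex.re_sum]
    refine Finset.sum_congr rfl fun j _ => ?_
    rw [Matrix.mul_diagonal, Matrix.star_apply, ← mul_assoc, Complex.re_mul_ofReal]
    rfl
  have h2 : (W * Z * star U * star (W * Z * star U) * B).trace.re =
      ∑ j, ∑ i, hB.eigenvalues j * ‖Z j i‖ ^ 2 := by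
    have : (W * Z * star U * star (W * Z * star U) * B).trace = (Z * star Z * DB).trace := by
      conv_lhs => rw [hBe]
      simp only [star_mul, star_star, Matrix.mul_assoc, hU', hW']
      rw [Matrix.trace_mul_comm]
      simp only [Matrix.mul_assoc, hW, Matrix.mul_one]
    rw [this, Matrix.trace, Complex.re_sum]
    refine Finset.sum_congr rfl fun j _ => ?_
    rw [Matrix.diag_apply, Matrix.mul_diagonal, Matrix.mul_apply, Complex.re_mul_ofReal,
      Complex.re_sum, Finset.sum_mul]
    refine Finset.sum_congr rfl fun i _ => ?_
    rw [Matrix.star_apply, RCLike.star_def, Complex.mul_conj', ← Complex.ofReal_pow,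
      Complex.ofReal_re, mul_comm]
  have h3 : (star (W * Z * star U) * (W * Z * star U) * A).trace.re =
      ∑ j, ∑ i, hA.eigenvalues i * ‖Z j i‖ ^ 2 := by
    have : (star (W * Z * star U) * (W * Z * star U) * A).trace = (star Z * Z * DA).trace := by
      conv_lhs => rw [hAe]
      simp only [star_mul, star_star, Matrix.mul_assoc, hU', hW']
      rw [Matrix.trace_mul_comm]
      simp only [Matrix.mul_assoc, hU, Matrix.mul_one]
    rw [this, Matrix.trace, Complex.re_sum, Finset.sum_comm]
    refine Finset.sum_congr rfl fun i _ => ?_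
    rw [Matrix.diag_apply, Matrix.mul_diagonal, Matrix.mul_apply, Complex.re_mul_ofReal,
      Complex.re_sum, Finset.sum_mul]
    refine Finset.sum_congr rfl fun j _ => ?_
    rw [Matrix.star_apply, RCLike.star_def, Complex.conj_mul', ← Complex.ofReal_pow,
      Complex.ofReal_re, mul_comm]
  rw [resolventFunctional, h1, h2, h3]
  simp only [Finset.mul_sum, ← Finset.sum_sub_distrib]
  refine Finset.sum_congr rfl fun j _ => Finset.sum_congr rfl fun i _ => ?_
  ring

lemma two_mul_re_mul_sub_le (z g : ℂ) {a m : ℝ} (hm : 0 < m) :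
    2 * (star z * g).re * a - m * ‖z‖ ^ 2 ≤ ‖g‖ ^ 2 * (a ^ 2 / m) := by
  rw [← mul_div_assoc, le_div_iff₀ hm, Complex.sq_norm, Complex.sq_norm, Complex.normSq_apply,
    Complex.normSq_apply]
  simp only [RCLike.star_def, Complex.mul_re, Complex.conj_re, Complex.conj_im]
  nlinarith [sq_nonneg (m * z.re - a * g.re), sq_nonneg (m * z.im - a * g.im)]

lemma two_mul_re_mul_sub_eq (g : ℂ) {a m : ℝ} (hm : 0 < m) :
    2 * (star (((a / m : ℝ) : ℂ) * g) * g).re * a - m * ‖((a / m : ℝ) : ℂ) * g‖ ^ 2 =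
      ‖g‖ ^ 2 * (a ^ 2 / m) := by
  have h1 : (star (((a / m : ℝ) : ℂ) * g) * g).re = a / m * ‖g‖ ^ 2 := by
    rw [star_mul', mul_assoc, RCLike.star_def, Complex.conj_mul', Complex.conj_ofReal,
      ← Complex.ofReal_pow, ← Complex.ofReal_mul, Complex.ofReal_re]
  rw [h1, norm_mul, mul_pow, Complex.norm_real, Real.norm_eq_abs, sq_abs]
  field_simp
  ring

lemma resolventFunctional_le (hA : A.PosSemidef) (hB : B.PosSemidef) {s : ℝ} (hs : 0 < s)
    (Y : Matrix (Fin d) (Fin d) ℂ) :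
    resolventFunctional A B s Y ≤ resolventForm hA.isHermitian hB.isHermitian s := by
  have hY : Y = eigU hB.isHermitian * (star (eigU hB.isHermitian) * Y * eigU hA.isHermitian) *
      star (eigU hA.isHermitian) := by
    simp only [Matrix.mul_assoc, eigU_mul_star, Matrix.mul_one]
    rw [← Matrix.mul_assoc, eigU_mul_star, Matrix.one_mul]
  rw [hY, resolventFunctional_eq_sum, resolventForm]
  refine Finset.sum_le_sum fun j _ => Finset.sum_le_sum fun i _ => ?_
  have hi := hA.eigenvalues_nonneg i
  have hj := hB.eigenvalues_nonneg j
  rcases hi.eq_or_lt with h | h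
  · rw [← h]
    simp only [mul_zero, add_zero, zero_sub, ne_eq, OfNat.ofNat_ne_zero, not_false_eq_true,
      zero_pow, zero_div, Left.neg_nonpos_iff]
    positivity
  · exact two_mul_re_mul_sub_le _ _ (by positivity)

lemma exists_resolventFunctional_eq (hA : A.PosSemidef) (hB : B.PosSemidef) {s : ℝ}
    (hs : 0 < s) :
    ∃ Y, resolventFunctional A B s Y = resolventForm hA.isHermitian hB.isHermitian s := by
  refine ⟨eigU hB.isHermitian * (Matrix.of fun j i =>
    ((hA.isHermitian.eigenvalues i / (hB.isHermitian.eigenvalues j +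
      s * hA.isHermitian.eigenvalues i) : ℝ) : ℂ) *
      overlap hA.isHermitian hB.isHermitian j i) * star (eigU hA.isHermitian), ?_⟩
  rw [resolventFunctional_eq_sum, resolventForm]
  refine Finset.sum_congr rfl fun j _ => Finset.sum_congr rfl fun i _ => ?_
  have hi := hA.eigenvalues_nonneg i
  have hj := hB.eigenvalues_nonneg j
  rcases hi.eq_or_lt with h | h
  · simp [← h]
  · exact two_mul_re_mul_sub_eq _ (by positivity)

/-- The Kadison–Schwarz inequality for a unital completely positive map in Kraus form, paired with
a positive semidefinite matrix. -/
lemma trace_schwarz_le {ι : Type*} [Fintype ι] (T X : ι → Matrix (Fin d) (Fin d) ℂ)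
    (hT : ∑ i, (T i)ᴴ * T i = 1) (hB : B.PosSemidef) :
    ((∑ i, (T i)ᴴ * X i * T i) * star (∑ i, (T i)ᴴ * X i * T i) * B).trace.re ≤
      ∑ i, (X i * star (X i) * (T i * B * (T i)ᴴ)).trace.re := by
  set Y := ∑ i, (T i)ᴴ * X i * T i with hY
  have hYs : star Y = ∑ i, (T i)ᴴ * star (X i) * T i := by
    rw [hY, star_sum]
    simp only [Matrix.star_eq_conjTranspose, Matrix.conjTranspose_mul,
      Matrix.conjTranspose_conjTranspose, Matrix.mul_assoc]
  have key : ∑ i, (star (X i) * T i - T i * star Y)ᴴ * (star (X i) * T i - T i * star Y) =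
      ∑ i, (T i)ᴴ * (X i * star (X i)) * T i - Y * star Y := by
    have h : ∀ i, (star (X i) * T i - T i * star Y)ᴴ * (star (X i) * T i - T i * star Y) =
        (T i)ᴴ * (X i * star (X i)) * T i - ((T i)ᴴ * X i * T i) * star Y -
          Y * ((T i)ᴴ * star (X i) * T i) + Y * ((T i)ᴴ * T i) * star Y := fun i => by
      simp only [Matrix.star_eq_conjTranspose, Matrix.conjTranspose_sub, Matrix.conjTranspose_mul,
        Matrix.conjTranspose_conjTranspose]
      noncomm_ring
    simp only [h, Finset.sum_add_distrib, Finset.sum_sub_distrib, ← Finset.sum_mul,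
      ← Finset.mul_sum, hT, ← hYs, ← hY, Matrix.mul_one]
    abel
  have hnn : 0 ≤ ((∑ i, (T i)ᴴ * (X i * star (X i)) * T i - Y * star Y) * B).trace.re := by
    rw [← key, Finset.sum_mul, Matrix.trace_sum, Complex.re_sum]
    refine Finset.sum_nonneg fun i _ => ?_
    rw [Matrix.mul_assoc, Matrix.trace_mul_comm]
    exact (Complex.le_def.mp (hB.mul_mul_conjTranspose_same _).trace_nonneg).1
  rw [Matrix.sub_mul, Matrix.trace_sub, Complex.sub_re, Finset.sum_mul, Matrix.trace_sum,
    Complex.re_sum, sub_nonneg] at hnn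
  refine hnn.trans_eq (Finset.sum_congr rfl fun i _ => ?_)
  simp only [Matrix.mul_assoc]
  rw [Matrix.trace_mul_comm]
  simp only [Matrix.mul_assoc]

end Variational

section Instrument

variable {d : ℕ} {Ω K : Type*} [Fintype K] {A B : Matrix (Fin d) (Fin d) ℂ}
  (V : Ω → K → Matrix (Fin d) (Fin d) ℂ)

lemma instrOp_posSemidef (ω : Ω) (hA : A.PosSemidef) : (instrOp V ω A).PosSemidef :=
  Matrix.posSemidef_sum _ fun _ _ => hA.mul_mul_conjTranspose_same _

lemma instrOp_sub (ω : Ω) : instrOp V ω (A - B) = instrOp V ω A - instrOp V ω B := by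
  simp [instrOp, Matrix.mul_sub, Matrix.sub_mul]

lemma instrOp_smul (ω : Ω) (c : ℝ) : instrOp V ω (c • A) = c • instrOp V ω A := by
  simp [instrOp, Finset.smul_sum]

lemma instrOp_sum {X : Type*} [Fintype X] (ω : Ω) (f : X → Matrix (Fin d) (Fin d) ℂ) :
    instrOp V ω (∑ x, f x) = ∑ x, instrOp V ω (f x) := by
  simp only [instrOp, Finset.mul_sum, Finset.sum_mul]
  exact Finset.sum_comm

lemma outcomeProb_eq_trace (ω : Ω) : outcomeProb V A ω = (instrOp V ω A).trace.re := by
  rw [outcomeProb, instrPOV, instrOp, Finset.sum_mul, Matrix.trace_sum, Matrix.trace_sum]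
  congr 1
  refine Finset.sum_congr rfl fun k _ => ?_
  rw [Matrix.mul_assoc, Matrix.trace_mul_comm]

variable [Fintype Ω]

lemma sum_trace_instrOp (hV : ∑ ω, instrPOV V ω = 1) :
    ∑ ω, (instrOp V ω A).trace.re = A.trace.re := by
  simp only [← outcomeProb_eq_trace, outcomeProb]
  rw [← Complex.re_sum, ← Matrix.trace_sum, ← Finset.sum_mul, hV, Matrix.one_mul]

lemma sum_resolventForm_instrOp_le (hV : ∑ ω, instrPOV V ω = 1) (hA : A.PosSemidef)
    (hB : B.PosSemidef) {s : ℝ} (hs : 0 < s) :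
    ∑ ω, resolventForm (instrOp_posSemidef V ω hA).isHermitian
      (instrOp_posSemidef V ω hB).isHermitian s ≤
        resolventForm hA.isHermitian hB.isHermitian s := by
  choose X hX using fun ω =>
    exists_resolventFunctional_eq (instrOp_posSemidef V ω hA) (instrOp_posSemidef V ω hB) hs
  set T : Ω × K → Matrix (Fin d) (Fin d) ℂ := fun x => V x.1 x.2
  have hT : ∑ x, (T x)ᴴ * T x = 1 := by
    rw [Fintype.sum_prod_type]
    exact hV
  set Y := ∑ x, (T x)ᴴ * X x.1 * T x with hY
  have hYs : star Y = ∑ x, (T x)ᴴ * star (X x.1) * T x := by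
    rw [hY, star_sum]
    simp only [Matrix.star_eq_conjTranspose, Matrix.conjTranspose_mul,
      Matrix.conjTranspose_conjTranspose, Matrix.mul_assoc]
  have pair : ∀ (M : Ω → Matrix (Fin d) (Fin d) ℂ) (C : Matrix (Fin d) (Fin d) ℂ),
      ∑ x : Ω × K, (M x.1 * (T x * C * (T x)ᴴ)).trace.re =
        ∑ ω, (M ω * instrOp V ω C).trace.re := fun M C => by
    rw [Fintype.sum_prod_type]
    refine Finset.sum_congr rfl fun ω _ => ?_
    rw [instrOp, Finset.mul_sum, Matrix.trace_sum, Complex.re_sum]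
  have h1 : (star Y * A).trace.re = ∑ ω, (star (X ω) * instrOp V ω A).trace.re := by
    rw [← pair (fun ω => star (X ω)), hYs, Finset.sum_mul, Matrix.trace_sum, Complex.re_sum]
    refine Finset.sum_congr rfl fun x _ => ?_
    simp only [Matrix.mul_assoc]
    rw [Matrix.trace_mul_comm]
    simp only [Matrix.mul_assoc]
  have h2 := trace_schwarz_le T (fun x => X x.1) hT hB
  have h3 := trace_schwarz_le T (fun x => star (X x.1)) hT hA
  simp only [star_star] at h3
  rw [pair (fun ω => X ω * star (X ω)), ← hY] at h2
  rw [pair (fun ω => star (X ω) * X ω), ← hYs, star_star] at h3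
  refine le_trans ?_ (resolventFunctional_le hA hB hs Y)
  simp only [← hX, resolventFunctional, Finset.sum_sub_distrib, ← Finset.mul_sum, h1]
  nlinarith

end Instrument

section Monotonicity

open Filter Topology

variable {d : ℕ} {A B : Matrix (Fin d) (Fin d) ℂ}

/-- An antiderivative in `s` of `resolventForm hA hB s - tr A / (1 + s)`, interpolating between
`Tr (A log B)` at `s = 0` and `Tr (A log A)` at `s = ∞`. -/
noncomputable def logInterpolation (hA : A.IsHermitian) (hB : B.IsHermitian) (s : ℝ) : ℝ :=
  ∑ j, ∑ i, ‖overlap hA hB j i‖ ^ 2 * hA.eigenvalues i *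
    (Real.log (hB.eigenvalues j + s * hA.eigenvalues i) - Real.log (1 + s))

lemma eigenvalues_pos_of_overlap_ne_zero (hA : A.PosSemidef) (hB : B.PosSemidef) {c : ℝ}
    (hc : 0 < c) (hAB : (B - c • A).PosSemidef) {i j : Fin d}
    (h : ‖overlap hA.isHermitian hB.isHermitian j i‖ ^ 2 * hA.isHermitian.eigenvalues i ≠ 0) :
    0 < hA.isHermitian.eigenvalues i ∧ 0 < hB.isHermitian.eigenvalues j :=
  ⟨(hA.eigenvalues_nonneg i).lt_of_ne' (right_ne_zero_of_mul h),
    (hB.eigenvalues_nonneg j).lt_of_ne' fun hj =>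
      h (overlap_mul_eigenvalue_eq_zero hA hB.isHermitian hc hAB hj)⟩

lemma hasDerivAt_logInterpolation (hA : A.PosSemidef) (hB : B.PosSemidef) {c : ℝ}
    (hc : 0 < c) (hAB : (B - c • A).PosSemidef) {s : ℝ} (hs : 0 ≤ s) :
    HasDerivAt (logInterpolation hA.isHermitian hB.isHermitian)
      (resolventForm hA.isHermitian hB.isHermitian s - A.trace.re * (1 + s)⁻¹) s := by
  rw [resolventForm, trace_re_eq_sum_overlap hA.isHermitian hB.isHermitian, Finset.sum_mul,
    ← Finset.sum_sub_distrib]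
  refine HasDerivAt.fun_sum fun j _ => ?_
  rw [Finset.sum_mul, ← Finset.sum_sub_distrib]
  refine HasDerivAt.fun_sum fun i _ => ?_
  by_cases h : ‖overlap hA.isHermitian hB.isHermitian j i‖ ^ 2 *
      hA.isHermitian.eigenvalues i = 0
  · have h' : ‖overlap hA.isHermitian hB.isHermitian j i‖ ^ 2 *
        (hA.isHermitian.eigenvalues i ^ 2 /
          (hB.isHermitian.eigenvalues j + s * hA.isHermitian.eigenvalues i)) = 0 := by
      rcases mul_eq_zero.mp h with h | h <;> simp [h]
    simp only [h, h', zero_mul, sub_zero]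
    exact hasDerivAt_const s 0
  · obtain ⟨hi, hj⟩ := eigenvalues_pos_of_overlap_ne_zero hA hB hc hAB h
    have h1 : HasDerivAt (fun s : ℝ => hB.isHermitian.eigenvalues j +
        s * hA.isHermitian.eigenvalues i) (1 * hA.isHermitian.eigenvalues i) s :=
      ((hasDerivAt_id s).mul_const _).const_add _
    have h2 : HasDerivAt (fun s : ℝ => 1 + s) 1 s := (hasDerivAt_id s).const_add _
    have h3 := ((h1.log (by positivity)).sub (h2.log (by positivity))).const_mul
      (‖overlap hA.isHermitian hB.isHermitian j i‖ ^ 2 * hA.isHermitian.eigenvalues i)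
    refine h3.congr_deriv ?_
    ring

lemma tendsto_log_add_mul_sub_log {l m : ℝ} (hl : 0 < l) :
    Tendsto (fun s : ℝ => Real.log (m + s * l) - Real.log (1 + s)) atTop (𝓝 (Real.log l)) := by
  have h1 : Tendsto (fun s : ℝ => l + (m - l) / (1 + s)) atTop (𝓝 (l + 0)) :=
    (tendsto_const_nhds.div_atTop (tendsto_atTop_add_const_left _ _ tendsto_id)).const_add _
  rw [add_zero] at h1
  refine (h1.log hl.ne').congr' ?_
  filter_upwards [eventually_gt_atTop 0, eventually_gt_atTop (-m / l)] with s hs hs'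
  have hpos : 0 < m + s * l := by
    rw [div_lt_iff₀ hl] at hs'
    linarith
  rw [← Real.log_div hpos.ne' (by positivity)]
  congr 1
  field_simp
  ring

lemma tendsto_logInterpolation (hA : A.PosSemidef) (hB : B.IsHermitian) :
    Tendsto (logInterpolation hA.isHermitian hB) atTop
      (𝓝 (qRelEntropy A B + logInterpolation hA.isHermitian hB 0)) := by
  have h : qRelEntropy A B + logInterpolation hA.isHermitian hB 0 =
      ∑ j, ∑ i, ‖overlap hA.isHermitian hB j i‖ ^ 2 * hA.isHermitian.eigenvalues i *
        Real.log (hA.isHermitian.eigenvalues i) := by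
    rw [qRelEntropy_eq_sum hA.isHermitian hB, logInterpolation, ← Finset.sum_add_distrib]
    refine Finset.sum_congr rfl fun j _ => ?_
    rw [← Finset.sum_add_distrib]
    refine Finset.sum_congr rfl fun i _ => ?_
    simp only [zero_mul, add_zero, Real.log_one, sub_zero]
    ring
  rw [h]
  refine tendsto_finsetSum _ fun j _ => tendsto_finsetSum _ fun i _ => ?_
  rcases (hA.eigenvalues_nonneg i).eq_or_lt with h0 | h0
  · simp [← h0]
  · exact (tendsto_log_add_mul_sub_log h0).const_mul _

variable {Ω K : Type*} [Fintype Ω] [Fintype K]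

/-- Monotonicity of the quantum relative entropy under an instrument whose outcome is recorded. -/
theorem sum_qRelEntropy_instrOp_le (V : Ω → K → Matrix (Fin d) (Fin d) ℂ)
    (hV : ∑ ω, instrPOV V ω = 1) (hA : A.PosSemidef) (hB : B.PosSemidef) {c : ℝ} (hc : 0 < c)
    (hAB : (B - c • A).PosSemidef) :
    ∑ ω, qRelEntropy (instrOp V ω A) (instrOp V ω B) ≤ qRelEntropy A B := by
  have hAω := fun ω => instrOp_posSemidef V ω hA
  have hBω := fun ω => instrOp_posSemidef V ω hB
  have hABω : ∀ ω, (instrOp V ω B - c • instrOp V ω A).PosSemidef := fun ω => by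
    rw [← instrOp_smul, ← instrOp_sub]
    exact instrOp_posSemidef V ω hAB
  set F : ℝ → ℝ := fun s => logInterpolation hA.isHermitian hB.isHermitian s -
    ∑ ω, logInterpolation (hAω ω).isHermitian (hBω ω).isHermitian s
  have hF : ∀ s, 0 ≤ s → HasDerivAt F (resolventForm hA.isHermitian hB.isHermitian s -
      ∑ ω, resolventForm (hAω ω).isHermitian (hBω ω).isHermitian s) s := fun s hs => by
    refine ((hasDerivAt_logInterpolation hA hB hc hAB hs).sub (HasDerivAt.fun_sum fun ω _ =>
      hasDerivAt_logInterpolation (hAω ω) (hBω ω) hc (hABω ω) hs)).congr_deriv ?_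
    rw [Finset.sum_sub_distrib, ← Finset.sum_mul, sum_trace_instrOp V hV]
    ring
  have hmono : MonotoneOn F (Set.Ici 0) := by
    refine monotoneOn_of_deriv_nonneg (convex_Ici 0)
      (fun s hs => (hF s hs).continuousAt.continuousWithinAt) (fun s hs => ?_) (fun s hs => ?_)
    all_goals rw [interior_Ici, Set.mem_Ioi] at hs
    · exact (hF s hs.le).differentiableAt.differentiableWithinAt
    · rw [(hF s hs.le).deriv, sub_nonneg]
      exact sum_resolventForm_instrOp_le V hV hA hB hs
  have hlim := (tendsto_logInterpolation hA hB.isHermitian).sub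
    (tendsto_finsetSum Finset.univ fun ω _ =>
      tendsto_logInterpolation (hAω ω) (hBω ω).isHermitian)
  have hle : F 0 ≤ _ := ge_of_tendsto hlim ((eventually_ge_atTop 0).mono fun s hs =>
    hmono Set.self_mem_Ici hs hs)
  rw [Finset.sum_add_distrib] at hle
  simp only [F] at hle
  linarith

end Monotonicity

lemma sum_filter_pos_mul {X : Type*} [Fintype X] {f : X → ℝ} (hf : ∀ x, 0 ≤ f x) (g : X → ℝ) :
    ∑ x ∈ Finset.univ.filter (fun x => 0 < f x), f x * g x = ∑ x, f x * g x := by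
  refine Finset.sum_filter_of_ne fun x _ hx => ?_
  exact (hf x).lt_of_ne' (left_ne_zero_of_mul hx)

lemma posSemidef_real_smul {d : ℕ} {A : Matrix (Fin d) (Fin d) ℂ} (hA : A.PosSemidef) {c : ℝ}
    (hc : 0 ≤ c) : (c • A).PosSemidef := by
  have : c • A = (c : ℂ) • A := by
    ext i j
    simp
  rw [this]
  exact hA.smul (Complex.zero_le_real.mpr hc)

lemma posSemidef_sum_sub_self {d : ℕ} {A : Type*} [Fintype A]
    {f : A → Matrix (Fin d) (Fin d) ℂ} (hf : ∀ α, (f α).PosSemidef) (α : A) :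
    (∑ β, f β - f α).PosSemidef := by
  classical
  rw [← Finset.add_sum_erase _ _ (Finset.mem_univ α), add_sub_cancel_left]
  exact Matrix.posSemidef_sum _ fun β _ => hf β

lemma outcomeProb_nonneg {d : ℕ} {Ω K : Type*} [Fintype K] (V : Ω → K → Matrix (Fin d) (Fin d) ℂ)
    {A : Matrix (Fin d) (Fin d) ℂ} (hA : A.PosSemidef) (ω : Ω) : 0 ≤ outcomeProb V A ω := by
  rw [outcomeProb_eq_trace]
  exact (Complex.le_def.mp (instrOp_posSemidef V ω hA).trace_nonneg).1

lemma instrOp_eq_zero {d : ℕ} {Ω K : Type*} [Fintype K] (V : Ω → K → Matrix (Fin d) (Fin d) ℂ)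
    {A : Matrix (Fin d) (Fin d) ℂ} (hA : A.PosSemidef) {ω : Ω} (h : outcomeProb V A ω = 0) :
    instrOp V ω A = 0 := by
  have hR := instrOp_posSemidef V ω hA
  rw [outcomeProb_eq_trace] at h
  exact hR.trace_eq_zero_iff.mp (Complex.ext h (Complex.le_def.mp hR.trace_nonneg).2.symm)

/-- the Schumacher–Westmoreland–Wootters bound (generalized). -/
theorem sww_bound {d : ℕ} (hd : 1 ≤ d)
    {A Ω K : Type*} [Fintype A] [Fintype Ω] [Fintype K]
    (p : A → ℝ) (hp : ∀ α, 0 ≤ p α) (hp1 : ∑ α, p α = 1)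
    (ρ : A → Matrix (Fin d) (Fin d) ℂ)
    (hρ : ∀ α, (ρ α).PosSemidef) (hρtr : ∀ α, (ρ α).trace = 1)
    (V : Ω → K → Matrix (Fin d) (Fin d) ℂ)
    (hV : ∑ ω, instrPOV V ω = 1) :
    let η := ∑ α, p α • ρ α
    let pf := fun ω => outcomeProb V η ω
    let pfi := fun ω α => outcomeProb V (ρ α) ω
    let ρf := fun α ω => (pfi ω α)⁻¹ • instrOp V ω (ρ α)
    chiQuantity p ρ ≥
      mutualInfo p ρ (instrPOV V) +
        ∑ ω ∈ Finset.univ.filter (fun ω => 0 < pf ω),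
          pf ω * chiQuantity (fun α => p α * pfi ω α / pf ω) (fun α => ρf α ω) := by
  intro η pf pfi ρf
  have hη : η.PosSemidef := Matrix.posSemidef_sum _ fun α _ => posSemidef_real_smul (hρ α) (hp α)
  have hdom : ∀ α, (η - p α • ρ α).PosSemidef :=
    posSemidef_sum_sub_self fun α => posSemidef_real_smul (hρ α) (hp α)
  have hpfi : ∀ ω α, 0 ≤ pfi ω α := fun ω α => outcomeProb_nonneg V (hρ α) ω
  have hpf : ∀ ω, 0 ≤ pf ω := fun ω => outcomeProb_nonneg V hη ω
  have hSsum : ∀ ω, instrOp V ω η = ∑ α, p α • instrOp V ω (ρ α) := fun ω => by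
    simp only [η, instrOp_sum, instrOp_smul]
  have hpfsum : ∀ ω, pf ω = ∑ α, p α * pfi ω α := fun ω => by
    simp only [pf, pfi, outcomeProb_eq_trace, hSsum, Matrix.trace_sum, Complex.re_sum,
      Matrix.trace_smul, Complex.smul_re, smul_eq_mul]
  have havg : ∀ ω, ∑ α, (p α * pfi ω α / pf ω) • ρf α ω = (pf ω)⁻¹ • instrOp V ω η := fun ω => by
    rw [hSsum, Finset.smul_sum]
    refine Finset.sum_congr rfl fun α _ => ?_
    simp only [ρf, smul_smul]
    by_cases h : pfi ω α = 0
    · simp only [instrOp_eq_zero V (hρ α) h, smul_zero]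
    · congr 1
      field_simp
  have hterm : ∀ α ω, p α * pfi ω α * Real.log (p α * pfi ω α / (p α * pf ω)) +
      pf ω * (p α * pfi ω α / pf ω * qRelEntropy (ρf α ω) ((pf ω)⁻¹ • instrOp V ω η)) =
        p α * qRelEntropy (instrOp V ω (ρ α)) (instrOp V ω η) := fun α ω => by
    rcases (hp α).eq_or_lt with hα | hα
    · simp [← hα]
    rcases (hpfi ω α).eq_or_lt with hq | hq
    · rw [instrOp_eq_zero V (hρ α) hq.symm, ← hq]
      simp [qRelEntropy]
    have hf : 0 < pf ω := by
      rw [hpfsum]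
      exact (mul_pos hα hq).trans_le (Finset.single_le_sum (f := fun α => p α * pfi ω α)
        (fun β _ => mul_nonneg (hp β) (hpfi ω β)) (Finset.mem_univ α))
    have hRS : (instrOp V ω η - p α • instrOp V ω (ρ α)).PosSemidef := by
      rw [← instrOp_smul, ← instrOp_sub]
      exact instrOp_posSemidef V ω (hdom α)
    have hD := qRelEntropy_smul_smul_eq (instrOp_posSemidef V ω (hρ α))
      (instrOp_posSemidef V ω hη).isHermitian hα hRS (inv_pos.mpr hq) (inv_pos.mpr hf)
    rw [← outcomeProb_eq_trace] at hD
    change qRelEntropy (ρf α ω) ((pf ω)⁻¹ • instrOp V ω η) = (pfi ω α)⁻¹ * (_ + _ * pfi ω α) at hD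
    rw [hD, mul_div_mul_left _ _ hα.ne', Real.log_div hq.ne' hf.ne', Real.log_inv, Real.log_inv]
    field_simp
    ring
  have hchi : chiQuantity p ρ = ∑ α, p α * qRelEntropy (ρ α) η := sum_filter_pos_mul hp _
  have hmut : mutualInfo p ρ (instrPOV V) =
      ∑ α, ∑ ω, p α * pfi ω α * Real.log (p α * pfi ω α / (p α * pf ω)) := by
    rw [← Fintype.sum_prod_type']
    exact sum_filter_pos_mul (fun x : A × Ω => mul_nonneg (hp x.1) (hpfi x.2 x.1)) _
  have hpost : ∑ ω ∈ Finset.univ.filter (fun ω => 0 < pf ω),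
      pf ω * chiQuantity (fun α => p α * pfi ω α / pf ω) (fun α => ρf α ω) =
        ∑ α, ∑ ω, pf ω * (p α * pfi ω α / pf ω *
          qRelEntropy (ρf α ω) ((pf ω)⁻¹ • instrOp V ω η)) := by
    rw [sum_filter_pos_mul hpf, Finset.sum_comm]
    refine Finset.sum_congr rfl fun ω _ => ?_
    rw [chiQuantity, havg, sum_filter_pos_mul fun α =>
      div_nonneg (mul_nonneg (hp α) (hpfi ω α)) (hpf ω), Finset.mul_sum]
  rw [hchi, hmut, hpost, ← Finset.sum_add_distrib]
  refine Finset.sum_le_sum fun α _ => ?_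
  rw [← Finset.sum_add_distrib]
  simp only [hterm]
  rw [← Finset.mul_sum]
  rcases (hp α).eq_or_lt with hα | hα
  · simp [← hα]
  · exact mul_le_mul_of_nonneg_left (sum_qRelEntropy_instrOp_le V hV (hρ α) hη hα (hdom α)) hα.le
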